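/- Let p : ℝ → ℝ be continuous and strictly positive on the interval [0, T], and let g(t) = ∫₀ᵗ (φ_g + ψ_g·x)·p(x) dx and h(t) = ∫₀ᵗ (φ_h + ψ_h·x)·p(x) dx. Assume φ_g + ψ_g·t > 0 for all t in [0, T] and φ_g·ψ_h − ψ_g·φ_h ≥ 0. Then g is strictly increasing on [0, T], and the function h ∘ g⁻¹ (where g⁻¹ denotes the inverse of the restriction of g to [0, T]) is convex on the interval [g(0), g(T)]; that is, h is a convex function of g. -/

import Mathlib

open MeasureTheory intervalIntegral

/-- An affine function times a function continuous on `[0, T]` is integrable between any two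
points of `[0, T]`. -/
lemma intervalIntegrable_affine_mul {p : ℝ → ℝ} {T : ℝ} (hp : ContinuousOn p (Set.Icc 0 T))
    (φ ψ : ℝ) {s t : ℝ} (hs : s ∈ Set.Icc 0 T) (ht : t ∈ Set.Icc 0 T) :
    IntervalIntegrable (fun x => (φ + ψ * x) * p x) volume s t := by
  apply ContinuousOn.intervalIntegrable
  have hsub : Set.uIcc s t ⊆ Set.Icc 0 T := Set.uIcc_subset_Icc hs ht
  exact (Continuous.continuousOn (by fun_prop)).mul (hp.mono hsub)

/-- The oriented integral from `s` to `t` of `(x - s) * p x` is nonnegative when `p` is. -/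
lemma integral_sub_mul_nonneg {p : ℝ → ℝ} {s t : ℝ} (hp : ∀ x ∈ Set.uIcc s t, 0 ≤ p x) :
    0 ≤ ∫ x in s..t, (x - s) * p x := by
  rcases le_total s t with hst | hts
  · refine integral_nonneg hst fun x hx => ?_
    exact mul_nonneg (sub_nonneg.2 hx.1) (hp x (Set.Icc_subset_uIcc hx))
  · rw [integral_symm, ← intervalIntegral.integral_neg]
    refine integral_nonneg hts fun x hx => ?_
    rw [← neg_mul, neg_sub]
    exact mul_nonneg (sub_nonneg.2 hx.2) (hp x (Set.Icc_subset_uIcc' hx))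

/-- A function `h` that lies above a supporting affine function of `g` at each point of `S` is a
convex function of `g`. -/
lemma convexOn_comp_invFunOn_of_support {α : Type*} [Nonempty α] {S : Set α} {g h : α → ℝ}
    {J : Set ℝ} (hJ : Convex ℝ J) (hsurj : Set.SurjOn g S J)
    (hsupp : ∀ s ∈ S, ∃ r : ℝ, ∀ t ∈ S, r * (g t - g s) ≤ h t - h s) :
    ConvexOn ℝ J (h ∘ Function.invFunOn g S) := by
  refine ⟨hJ, fun x hx y hy a b ha hb hab => ?_⟩
  have hz := hJ hx hy ha hb hab
  have hmem := fun {w} (hw : w ∈ J) => Function.invFunOn_mem (hsurj hw)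
  have heq := fun {w} (hw : w ∈ J) => Function.invFunOn_eq (hsurj hw)
  obtain ⟨r, hr⟩ := hsupp _ (hmem hz)
  have hrx := hr _ (hmem hx)
  have hry := hr _ (hmem hy)
  rw [heq hz, heq hx] at hrx
  rw [heq hz, heq hy] at hry
  simp only [Function.comp_apply, smul_eq_mul] at hrx hry ⊢
  obtain rfl : b = 1 - a := by linarith
  linarith [mul_le_mul_of_nonneg_left hrx ha, mul_le_mul_of_nonneg_left hry hb]

theorem utility_convexity
    (p : ℝ → ℝ) (T : ℝ) (hT : 0 ≤ T)
    (hp_cont : ContinuousOn p (Set.Icc 0 T))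
    (hp_pos : ∀ x ∈ Set.Icc (0:ℝ) T, 0 < p x)
    (φg ψg φh ψh : ℝ)
    (g h : ℝ → ℝ)
    (hg : ∀ t, g t = ∫ x in (0:ℝ)..t, (φg + ψg * x) * p x)
    (hh : ∀ t, h t = ∫ x in (0:ℝ)..t, (φh + ψh * x) * p x)
    (hgpos : ∀ t ∈ Set.Icc (0:ℝ) T, 0 < φg + ψg * t)
    (hdet : 0 ≤ φg * ψh - ψg * φh) :
    StrictMonoOn g (Set.Icc 0 T) ∧
      ConvexOn ℝ (Set.Icc (g 0) (g T))
        (h ∘ (Function.invFunOn g (Set.Icc 0 T))) := by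
  have h0 : (0:ℝ) ∈ Set.Icc 0 T := ⟨le_rfl, hT⟩
  have hTm : T ∈ Set.Icc 0 T := ⟨hT, le_rfl⟩
  have hint := fun φ ψ {s t : ℝ} (hs : s ∈ Set.Icc 0 T) (ht : t ∈ Set.Icc 0 T) =>
    intervalIntegrable_affine_mul hp_cont φ ψ hs ht
  have hgsub : ∀ s ∈ Set.Icc 0 T, ∀ t ∈ Set.Icc 0 T,
      g t - g s = ∫ x in s..t, (φg + ψg * x) * p x := fun s hs t ht => by
    rw [hg, hg, integral_interval_sub_left (hint _ _ h0 ht) (hint _ _ h0 hs)]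
  have hhsub : ∀ s ∈ Set.Icc 0 T, ∀ t ∈ Set.Icc 0 T,
      h t - h s = ∫ x in s..t, (φh + ψh * x) * p x := fun s hs t ht => by
    rw [hh, hh, integral_interval_sub_left (hint _ _ h0 ht) (hint _ _ h0 hs)]
  have hgcont : ContinuousOn g (Set.Icc 0 T) := by
    rw [funext hg, ← Set.uIcc_of_le hT]
    exact continuousOn_primitive_interval' (hint φg ψg h0 hTm) Set.left_mem_uIcc
  refine ⟨fun s hs t ht hst => ?_, ?_⟩
  · rw [← sub_pos, hgsub s hs t ht]
    refine intervalIntegral_pos_of_pos_on (hint _ _ hs ht) (fun x hx => ?_) hst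
    have hxT : x ∈ Set.Icc 0 T := ⟨hs.1.trans hx.1.le, hx.2.le.trans ht.2⟩
    exact mul_pos (hgpos x hxT) (hp_pos x hxT)
  refine convexOn_comp_invFunOn_of_support (convex_Icc _ _)
    (intermediate_value_Icc hT hgcont) fun s hs => ?_
  refine ⟨(φh + ψh * s) / (φg + ψg * s), fun t ht => ?_⟩
  have hpos := hgpos s hs
  have hne := hpos.ne'
  have key : h t - h s - (φh + ψh * s) / (φg + ψg * s) * (g t - g s) =
      (φg * ψh - ψg * φh) / (φg + ψg * s) * ∫ x in s..t, (x - s) * p x := by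
    rw [hgsub s hs t ht, hhsub s hs t ht, ← intervalIntegral.integral_const_mul,
      ← intervalIntegral.integral_const_mul,
      ← intervalIntegral.integral_sub (hint _ _ hs ht) ((hint _ _ hs ht).const_mul _)]
    refine integral_congr fun x _ => ?_
    linear_combination (-(φh + ψh * x) * p x) * mul_inv_cancel₀ hne
  rw [← sub_nonneg, key]
  exact mul_nonneg (div_nonneg hdet hpos.le) (integral_sub_mul_nonneg fun x hx =>
    (hp_pos x (Set.uIcc_subset_Icc hs ht hx)).le)
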